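/- arXiv:math/9610202 — 2 statements merged into one kernel-verified Lean document; each statement's English description precedes it below -/
import Mathlib

section
/- Let $0<m<n$, $s\ge 0$ integers, $k,h\in\mathbb{Z}$, $0<\alpha<1$, and consider on $\mathbb{R}^s\times\mathbb{R}^m\times\mathbb{C}^{n-m}$ (coordinates $(\rho,\eta,w)$, Lebesgue measure) the kernel $K\{\alpha,k,h,s\}(\rho,\eta,w,\epsilon)=\big(\epsilon+\sum_{i=1}^s|\rho_i|+\sum_{i=1}^m|\eta_i|+\sum_{i=1}^{n-m}|w_i|\big)^{-k}\big(\sqrt{\epsilon}+\sum_{i=1}^s\sqrt{|\rho_i|}+\sum_{i=1}^m\sqrt{|\eta_i|}+\sum_{i=1}^{n-m}|w_i|\big)^{-(2h-\alpha)}$ and $\mathcal{I}_2\{\alpha,k,h,s\}(\epsilon,\delta)=\int_{\mathbf{B}(1)\setminus\mathbf{V}(\delta)}K\{\alpha,k,h,s\}(\rho,\eta,w,\epsilon)\,d\lambda$. If either ($k\ge 2n-2m$ and $k+h-s\le 2n-m$) or ($k\le 2n-2m-1$ and $k+2(h-s)\le 2n+2$), then there exists $C>0$ such that for all $\epsilon\in(0,1)$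 and all $\delta\in(0,1)$ one has $\mathcal{I}_2\{\alpha,k,h,s\}(\epsilon,\delta)\le C\,\delta^{\alpha-2}$. -/
open MeasureTheory

lemma radial_integrable {E : Type*} [NormedAddCommGroup E] [NormedSpace ℝ E] [MeasureSpace E]
    [BorelSpace E] [FiniteDimensional ℝ E] [Nontrivial E] [(volume : Measure E).IsAddHaarMeasure]
    (a b p : ℝ) (hb : 0 ≤ b) (ha : a < Module.finrank ℝ E)
    (hab : (Module.finrank ℝ E : ℝ) < a + p * b) :
    Integrable (fun x : E => ‖x‖ ^ (-a) * (1 + ‖x‖ ^ p) ^ (-b)) := by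
  have hD : 0 < Module.finrank ℝ E := Module.finrank_pos
  have := integrable_fun_norm_addHaar (volume : Measure E)
    (f := fun y : ℝ => y ^ (-a) * (1 + y ^ p) ^ (-b))
  rw [this]
  rw [← Set.Ioc_union_Ioi_eq_Ioi (zero_le_one (α := ℝ))]
  set D := Module.finrank ℝ E with hDdef
  have hmeas : Measurable (fun y : ℝ => y ^ (D - 1) • (y ^ (-a) * (1 + y ^ p) ^ (-b))) := by
    fun_prop
  have hpow : ∀ y : ℝ, 0 < y → y ^ (D - 1) = y ^ ((D : ℝ) - 1) := by
    intro y hy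
    rw [← Real.rpow_natCast]
    congr 1
    rw [Nat.cast_sub hD]; simp
  refine IntegrableOn.union ?_ ?_
  · have h1 : IntegrableOn (fun y : ℝ => y ^ ((D : ℝ) - 1 - a)) (Set.Ioc 0 1) := by
      have := intervalIntegral.intervalIntegrable_rpow' (a := 0) (b := 1)
        (r := (D : ℝ) - 1 - a) (by linarith)
      rwa [intervalIntegrable_iff_integrableOn_Ioc_of_le zero_le_one] at this
    refine Integrable.mono' h1 hmeas.aestronglyMeasurable ?_
    refine (ae_restrict_iff' measurableSet_Ioc).2 (Filter.Eventually.of_forall ?_)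
    intro y hy
    have hy0 := hy.1
    have hq : 0 ≤ y ^ p := by positivity
    rw [Real.norm_of_nonneg (by positivity), hpow y hy0, smul_eq_mul, ← mul_assoc,
      ← Real.rpow_add hy0, sub_eq_add_neg _ a]
    refine mul_le_of_le_one_right (by positivity) ?_
    exact Real.rpow_le_one_of_one_le_of_nonpos (by linarith) (by linarith)
  · have h1 : IntegrableOn (fun y : ℝ => y ^ ((D : ℝ) - 1 - a - p * b)) (Set.Ioi 1) :=
      integrableOn_Ioi_rpow_of_lt (by linarith) one_pos
    refine Integrable.mono' h1 hmeas.aestronglyMeasurable ?_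
    refine (ae_restrict_iff' measurableSet_Ioi).2 (Filter.Eventually.of_forall ?_)
    intro y hy
    have hy0 : 0 < y := lt_trans one_pos hy
    have hq : 0 < y ^ p := by positivity
    rw [Real.norm_of_nonneg (by positivity), hpow y hy0, smul_eq_mul, ← mul_assoc,
      ← Real.rpow_add hy0, sub_eq_add_neg _ (p * b), Real.rpow_add hy0 _ (-(p * b)),
      sub_eq_add_neg _ a]
    refine mul_le_mul_of_nonneg_left ?_ (by positivity)
    rw [neg_mul_eq_mul_neg, Real.rpow_mul hy0.le]
    exact Real.rpow_le_rpow_of_nonpos hq (by linarith) (by linarith)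

lemma radial_scaled {E : Type*} [NormedAddCommGroup E] [NormedSpace ℝ E] [MeasureSpace E]
    [BorelSpace E] [FiniteDimensional ℝ E] [Nontrivial E] [(volume : Measure E).IsAddHaarMeasure]
    (a b p : ℝ) (hp : 0 < p) (hb : 0 ≤ b) (ha : a < Module.finrank ℝ E)
    (hab : (Module.finrank ℝ E : ℝ) < a + p * b) (δ : ℝ) (hδ : 0 < δ) :
    Integrable (fun x : E => ‖x‖ ^ (-a) * (δ + ‖x‖ ^ p) ^ (-b)) ∧
    ∫ x : E, ‖x‖ ^ (-a) * (δ + ‖x‖ ^ p) ^ (-b) =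
      δ ^ ((Module.finrank ℝ E - a) / p - b) *
        ∫ x : E, ‖x‖ ^ (-a) * (1 + ‖x‖ ^ p) ^ (-b) := by
  have h0 := radial_integrable (E := E) a b p hb ha hab
  set D := Module.finrank ℝ E with hDdef
  set R : ℝ := δ ^ (-1 / p) with hR
  have hRpos : 0 < R := by positivity
  have key : (fun x : E => ‖x‖ ^ (-a) * (δ + ‖x‖ ^ p) ^ (-b)) =
      fun x : E => δ ^ (-a / p - b) *
        (fun x : E => ‖x‖ ^ (-a) * (1 + ‖x‖ ^ p) ^ (-b)) (R • x) := by
    funext x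
    have e1 : ‖R • x‖ = R * ‖x‖ := by rw [norm_smul, Real.norm_of_nonneg hRpos.le]
    have e2 : R ^ p = δ⁻¹ := by
      rw [hR, ← Real.rpow_mul hδ.le, div_mul_cancel₀ _ hp.ne', Real.rpow_neg_one]
    have e3 : R ^ (-a) = δ ^ (a / p) := by
      rw [hR, ← Real.rpow_mul hδ.le]; congr 1; ring
    have hx : 0 ≤ ‖x‖ ^ p := by positivity
    have e4 : 1 + δ⁻¹ * ‖x‖ ^ p = δ⁻¹ * (δ + ‖x‖ ^ p) := by field_simp
    simp only [e1]
    rw [Real.mul_rpow hRpos.le (norm_nonneg _), Real.mul_rpow hRpos.le (norm_nonneg _), e2, e3, e4,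
      Real.mul_rpow (by positivity) (by positivity), Real.inv_rpow hδ.le, ← Real.rpow_neg hδ.le]
    have : δ ^ (-a / p - b) * δ ^ (a / p) * δ ^ (- -b) = 1 := by
      rw [← Real.rpow_add hδ, ← Real.rpow_add hδ]
      convert Real.rpow_zero δ using 2; ring
    linear_combination (-(‖x‖ ^ (-a) * (δ + ‖x‖ ^ p) ^ (-b))) * this
  rw [key]
  refine ⟨(((integrable_comp_smul_iff volume _ hRpos.ne').2 h0)).const_mul _, ?_⟩
  rw [integral_const_mul, Measure.integral_comp_smul volume
    (fun x : E => ‖x‖ ^ (-a) * (1 + ‖x‖ ^ p) ^ (-b)) R, smul_eq_mul, ← mul_assoc]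
  congr 1
  rw [abs_of_pos (by positivity), ← hDdef, hR, ← Real.rpow_natCast, ← Real.rpow_mul hδ.le,
    ← Real.rpow_neg hδ.le, ← Real.rpow_add hδ]
  congr 1; field_simp; ring

lemma ae_ne_pi {E : Type*} [NormedAddCommGroup E] [NormedSpace ℝ E] [MeasureSpace E]
    [BorelSpace E] [FiniteDimensional ℝ E] [Nontrivial E] [(volume : Measure E).IsAddHaarMeasure]
    (N : ℕ) :
    ∀ᵐ x : Fin N → E, ∀ i, x i ≠ 0 := by
  rw [ae_all_iff]
  intro i
  have h : ∀ᵐ x : E, x ≠ 0 := by simp [ae_iff]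
  exact (Measure.quasiMeasurePreserving_eval (fun _ => volume) i).ae h

lemma rpow_shift {P M e1 e2 : ℝ} (hP : 0 < P) (hPM : P ≤ M) (he : e1 ≤ e2) :
    P ^ e2 ≤ M ^ (e2 - e1) * P ^ e1 := by
  have : P ^ e2 = P ^ (e2 - e1) * P ^ e1 := by
    rw [← Real.rpow_add hP]; congr 1; ring
  rw [this]
  exact mul_le_mul_of_nonneg_right (Real.rpow_le_rpow hP.le hPM (by linarith)) (by positivity)

lemma prod_bound {ι : Type*} [Fintype ι] [Nonempty ι] {Q : ℝ} (hQ : 0 ≤ Q) (q : ι → ℝ)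
    (hq : ∀ i, 0 ≤ q i) (e : ℝ) (h : ∀ i, Q ≤ q i ^ e) :
    Q ≤ ∏ i, q i ^ (e / Fintype.card ι) := by
  have hc : (Fintype.card ι : ℝ) ≠ 0 := by exact_mod_cast Fintype.card_ne_zero
  have : Q = ∏ _i : ι, Q ^ (1 / (Fintype.card ι : ℝ)) := by
    rw [Finset.prod_const, Finset.card_univ, ← Real.rpow_natCast, ← Real.rpow_mul hQ,
      one_div_mul_cancel hc, Real.rpow_one]
  rw [this]
  refine Finset.prod_le_prod (fun i _ => by positivity) (fun i _ => ?_)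
  calc Q ^ (1 / (Fintype.card ι : ℝ)) ≤ (q i ^ e) ^ (1 / (Fintype.card ι : ℝ)) :=
        Real.rpow_le_rpow hQ (h i) (by positivity)
    _ = _ := by rw [← Real.rpow_mul (hq i)]; congr 1; ring

section pointwise
variable {ι κ : Type*} [Fintype ι] [Fintype κ]

lemma basic_facts (ε : ℝ) (hε : 0 < ε) (hε1 : ε < 1) (x : ι → ℝ) (y : κ → ℝ)
    (hx : ∀ i, 0 < x i) (hy : ∀ i, 0 < y i) (hx1 : ∀ i, x i ≤ 1) (hy1 : ∀ i, y i ≤ 1)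
    (A B M : ℝ) (hA : A = ε + ∑ i, x i + ∑ i, y i)
    (hB : B = √ε + ∑ i, √(x i) + ∑ i, y i) (hM : M = 1 + Fintype.card ι + Fintype.card κ) :
    0 < A ∧ 0 < B ∧ A ≤ B ∧ B ≤ M ∧ B ≤ M * √A ∧ (∀ i, x i ≤ A) ∧ (∀ i, y i ≤ A) ∧
      (∀ i, √(x i) ≤ B) ∧ (∀ i, y i ≤ B) := by
  have hsx : 0 ≤ ∑ i, x i := Finset.sum_nonneg fun i _ => (hx i).le
  have hsy : 0 ≤ ∑ i, y i := Finset.sum_nonneg fun i _ => (hy i).le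
  have hss : 0 ≤ ∑ i, √(x i) := Finset.sum_nonneg fun i _ => Real.sqrt_nonneg _
  have hse : 0 < √ε := Real.sqrt_pos.2 hε
  have lesq : ∀ z : ℝ, 0 ≤ z → z ≤ 1 → z ≤ √z := fun z h0 h1 => by
    apply Real.le_sqrt_of_sq_le; nlinarith
  have hApos : 0 < A := by rw [hA]; linarith
  have hxi : ∀ i, x i ≤ ∑ i, x i := fun i =>
    Finset.single_le_sum (f := x) (fun i _ => (hx i).le) (Finset.mem_univ i)
  have hyi : ∀ i, y i ≤ ∑ i, y i := fun i =>
    Finset.single_le_sum (f := y) (fun i _ => (hy i).le) (Finset.mem_univ i)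
  have hsi : ∀ i, √(x i) ≤ ∑ i, √(x i) := fun i =>
    Finset.single_le_sum (f := fun i => √(x i)) (fun i _ => Real.sqrt_nonneg _)
      (Finset.mem_univ i)
  have hxA : ∀ i, x i ≤ A := fun i => by rw [hA]; linarith [hxi i]
  have hyA : ∀ i, y i ≤ A := fun i => by rw [hA]; linarith [hyi i]
  have bound : ∀ T : ℝ, √ε ≤ T → (∀ i, √(x i) ≤ T) → (∀ i, y i ≤ T) → B ≤ M * T := by
    intro T h1 h2 h3
    have e1 : ∑ i, √(x i) ≤ Fintype.card ι * T := by
      calc _ ≤ ∑ _i : ι, T := Finset.sum_le_sum fun i _ => h2 i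
        _ = _ := by simp
    have e2 : ∑ i, y i ≤ Fintype.card κ * T := by
      calc _ ≤ ∑ _i : κ, T := Finset.sum_le_sum fun i _ => h3 i
        _ = _ := by simp
    rw [hB, hM]; linarith
  refine ⟨hApos, ?_, ?_, ?_, ?_, hxA, hyA, ?_, ?_⟩
  · rw [hB]; linarith
  · rw [hA, hB]
    have := Finset.sum_le_sum (s := Finset.univ) fun i _ => lesq (x i) (hx i).le (hx1 i)
    linarith [lesq ε hε.le hε1.le]
  · have := bound 1 (Real.sqrt_le_one.2 hε1.le) (fun i => Real.sqrt_le_one.2 (hx1 i)) hy1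
    linarith
  · refine bound _ (Real.sqrt_le_sqrt (by rw [hA]; linarith))
      (fun i => Real.sqrt_le_sqrt (hxA i))
      (fun i => (lesq _ (hy i).le (hy1 i)).trans (Real.sqrt_le_sqrt (hyA i)))
  · intro i; rw [hB]; linarith [hsi i]
  · intro i; rw [hB]; linarith [hyi i]

/-- Case 1: pointwise product bound. -/
lemma case1_pointwise [Nonempty ι] [Nonempty κ] (k h : ℤ) (α : ℝ) (hα0 : 0 < α) (hα1 : α < 1)
    (h1 : 2 * (Fintype.card κ : ℤ) ≤ k)
    (h2 : k + h ≤ 2 * (Fintype.card κ : ℤ) + Fintype.card ι) :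
    ∃ C > (0 : ℝ), ∀ (ε : ℝ) (_ : 0 < ε) (_ : ε < 1) (x : ι → ℝ) (y : κ → ℝ)
      (_ : ∀ i, 0 < x i) (_ : ∀ i, 0 < y i) (_ : ∀ i, x i ≤ 1) (_ : ∀ i, y i ≤ 1),
      (ε + ∑ i, x i + ∑ i, y i) ^ (-k) *
        (√ε + ∑ i, √(x i) + ∑ i, y i) ^ (-(2 * (h : ℝ) - α)) ≤
      C * ((∏ i, x i ^ (-(Fintype.card ι - α / 4) / Fintype.card ι)) *
        ∏ i, y i ^ (-(2 * Fintype.card κ - α / 4) / Fintype.card κ)) := by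
  set d := Fintype.card ι
  set N := Fintype.card κ
  set M : ℝ := 1 + d + N with hM
  have hM1 : 1 ≤ M := by rw [hM]; have : (0 : ℝ) ≤ d + N := by positivity
                         linarith
  have hM0 : 0 < M := by linarith
  have h1' : 2 * (N : ℝ) ≤ k := by exact_mod_cast h1
  have h2' : (k : ℝ) + h ≤ 2 * N + d := by exact_mod_cast h2
  set C : ℝ := 1 + M ^ (α - 2 * h) * M ^ ((-(k + h - 2 * N + α / 4 - α / 2)) - (-(d - α / 4)))
    with hC
  have hC1 : 1 ≤ C := by
    rw [hC]; linarith [mul_pos (Real.rpow_pos_of_pos hM0 (α - 2 * h)) (Real.rpow_pos_of_pos hM0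
      ((-(k + h - 2 * N + α / 4 - α / 2)) - (-(d - α / 4))))]
  refine ⟨C, by linarith, ?_⟩
  intro ε hε hε1 x y hx hy hx1 hy1
  obtain ⟨hA, hB, hAB, hBM, hBA, hxA, hyA, hxB, hyB⟩ :=
    basic_facts ε hε hε1 x y hx hy hx1 hy1 _ _ M rfl rfl hM
  set A := ε + ∑ i, x i + ∑ i, y i
  set B := √ε + ∑ i, √(x i) + ∑ i, y i
  rw [← Real.rpow_intCast]
  have hd : (1 : ℝ) ≤ d := by exact_mod_cast Fintype.card_pos
  have hN : (1 : ℝ) ≤ N := by exact_mod_cast Fintype.card_pos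
  have split : A ^ (((-k : ℤ)) : ℝ) = A ^ (-(2 * N - α / 4)) * A ^ (-(k - 2 * N + α / 4)) := by
    rw [← Real.rpow_add hA]; congr 1; push_cast; ring
  have hY : A ^ (-(2 * (N : ℝ) - α / 4)) ≤ ∏ i, y i ^ (-(2 * (N : ℝ) - α / 4) / N) :=
    prod_bound (by positivity) y (fun i => (hy i).le) _ fun i =>
      Real.rpow_le_rpow_of_nonpos (hy i) (hyA i) (by linarith)
  have hX : A ^ (-((k : ℝ) - 2 * N + α / 4)) * B ^ (-(2 * (h : ℝ) - α)) / C ≤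
      ∏ i, x i ^ (-((d : ℝ) - α / 4) / d) := by
    refine prod_bound (by positivity) x (fun i => (hx i).le) _ fun i => ?_
    rw [div_le_iff₀ (by linarith)]
    have hpos : 0 < x i ^ (-((d : ℝ) - α / 4)) := Real.rpow_pos_of_pos (hx i) _
    rcases le_or_gt h 0 with hh | hh
    · have hh' : (h : ℝ) ≤ 0 := by exact_mod_cast hh
      have b1 : B ^ (-(2 * (h : ℝ) - α)) ≤ M ^ (α - 2 * h) * A ^ (α / 2 - h) := by
        calc B ^ (-(2 * (h : ℝ) - α)) ≤ (M * √A) ^ (-(2 * (h : ℝ) - α)) :=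
              Real.rpow_le_rpow hB.le hBA (by linarith)
          _ = _ := by
              rw [Real.mul_rpow hM0.le (Real.sqrt_nonneg _), Real.sqrt_eq_rpow,
                ← Real.rpow_mul hA.le]
              congr 2 <;> ring
      calc A ^ (-((k : ℝ) - 2 * N + α / 4)) * B ^ (-(2 * (h : ℝ) - α))
          ≤ A ^ (-((k : ℝ) - 2 * N + α / 4)) * (M ^ (α - 2 * h) * A ^ (α / 2 - h)) := by gcongr
        _ = M ^ (α - 2 * h) * A ^ (-((k : ℝ) + h - 2 * N + α / 4 - α / 2)) := by
            rw [mul_left_comm, ← Real.rpow_add hA]; congr 2; ring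
        _ ≤ M ^ (α - 2 * h) * (M ^ ((-(k + h - 2 * N + α / 4 - α / 2)) - (-(d - α / 4))) *
              A ^ (-((d : ℝ) - α / 4))) := by
            gcongr
            exact rpow_shift hA (hAB.trans hBM) (by linarith)
        _ ≤ M ^ (α - 2 * h) * (M ^ ((-(k + h - 2 * N + α / 4 - α / 2)) - (-(d - α / 4))) *
              x i ^ (-((d : ℝ) - α / 4))) := by
            gcongr 2
            exact Real.rpow_le_rpow_of_nonpos (hx i) (hxA i) (by linarith)
        _ ≤ _ := by rw [hC]; nlinarith
    · have hh' : (1 : ℝ) ≤ h := by exact_mod_cast hh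
      calc A ^ (-((k : ℝ) - 2 * N + α / 4)) * B ^ (-(2 * (h : ℝ) - α))
          ≤ x i ^ (-((k : ℝ) - 2 * N + α / 4)) * √(x i) ^ (-(2 * (h : ℝ) - α)) := by
            exact mul_le_mul (Real.rpow_le_rpow_of_nonpos (hx i) (hxA i) (by linarith))
              (Real.rpow_le_rpow_of_nonpos (Real.sqrt_pos.2 (hx i)) (hxB i) (by linarith))
              (by positivity) (Real.rpow_nonneg (hx i).le _)
        _ = x i ^ (-((k : ℝ) + h - 2 * N + α / 4 - α / 2)) := by
            rw [Real.sqrt_eq_rpow, ← Real.rpow_mul (hx i).le, ← Real.rpow_add (hx i)]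
            congr 1; ring
        _ ≤ x i ^ (-((d : ℝ) - α / 4)) :=
            Real.rpow_le_rpow_of_exponent_ge (hx i) (hx1 i) (by linarith)
        _ ≤ _ := le_mul_of_one_le_right hpos.le hC1
  rw [div_le_iff₀ (by linarith)] at hX
  rw [split, mul_assoc]
  calc _ ≤ (∏ i, y i ^ (-(2 * (N : ℝ) - α / 4) / N)) *
        ((∏ i, x i ^ (-((d : ℝ) - α / 4) / d)) * C) := by
        gcongr
        exact Finset.prod_nonneg fun i _ => Real.rpow_nonneg (hy i).le _
    _ = _ := by ring

/-- Case 2: pointwise product bound. -/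
lemma case2_pointwise [Nonempty ι] [Nonempty κ] (k h : ℤ) (α : ℝ) (hα0 : 0 < α) (hα1 : α < 1)
    (h1 : k ≤ 2 * (Fintype.card κ : ℤ) - 1)
    (h2 : k + 2 * h ≤ 2 * (Fintype.card κ : ℤ) + 2 * Fintype.card ι + 2)
    (q η : ℝ) (hq : q = max (k : ℝ) 0 / Fintype.card κ)
    (hη : η = (2 - α) / (Fintype.card ι + Fintype.card κ)) :
    ∃ C > (0 : ℝ), ∀ (ε : ℝ) (_ : 0 < ε) (_ : ε < 1) (δ : ℝ) (_ : 0 < δ)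
      (x : ι → ℝ) (y : κ → ℝ)
      (_ : ∀ i, 0 < x i) (_ : ∀ i, 0 < y i) (_ : ∀ i, x i ≤ 1) (_ : ∀ i, y i ≤ 1)
      (_ : δ ^ 2 ≤ ∑ i, x i + ∑ i, y i ^ 2),
      (ε + ∑ i, x i + ∑ i, y i) ^ (-k) *
        (√ε + ∑ i, √(x i) + ∑ i, y i) ^ (-(2 * (h : ℝ) - α)) ≤
      C * ((∏ i, (δ + √(x i)) ^ (-(2 + η))) *
        ∏ i, (y i ^ (-q) * (δ + y i) ^ (-(2 - q + η)))) := by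
  set d := Fintype.card ι
  set N := Fintype.card κ
  set M : ℝ := 1 + d + N with hM
  have hM1 : 1 ≤ M := by rw [hM]; have : (0 : ℝ) ≤ d + N := by positivity
                         linarith
  have hM0 : 0 < M := by linarith
  have hd : (1 : ℝ) ≤ d := by exact_mod_cast Fintype.card_pos
  have hN : (1 : ℝ) ≤ N := by exact_mod_cast Fintype.card_pos
  have h1' : (k : ℝ) ≤ 2 * N - 1 := by exact_mod_cast h1
  have h2' : (k : ℝ) + 2 * h ≤ 2 * N + 2 * d + 2 := by exact_mod_cast h2
  set K : ℝ := max (k : ℝ) 0 with hK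
  have hK0 : 0 ≤ K := le_max_right _ _
  have hKk : (k : ℝ) ≤ K := le_max_left _ _
  have hKN : K < 2 * N := by rw [hK]; apply max_lt <;> linarith
  have hqN : N * q = K := by rw [hq]; field_simp
  have hq2 : q < 2 := by rw [hq, div_lt_iff₀ (by linarith)]; linarith
  have hq0 : 0 ≤ q := by rw [hq]; positivity
  have hηN : (d + N) * η = 2 - α := by rw [hη]; field_simp
  have hη0 : 0 < η := by rw [hη]; apply div_pos <;> linarith
  set E : ℝ := d * (2 + η) + N * (2 - q + η) with hE
  have hEe : E = 2 * d + 2 * N + 2 - α - K := by rw [hE]; linarith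
  refine ⟨M ^ ((K - k - (2 * h - α)) - (-E)) * 2 ^ E, by positivity, ?_⟩
  intro ε hε hε1 δ hδ x y hx hy hx1 hy1 hreg
  obtain ⟨hA, hB, hAB, hBM, hBA, hxA, hyA, hxB, hyB⟩ :=
    basic_facts ε hε hε1 x y hx hy hx1 hy1 _ _ M rfl rfl hM
  have hδB : δ ≤ √ε + ∑ i, √(x i) + ∑ i, y i := by
    have e1 : ∑ i, x i ≤ (∑ i, √(x i)) ^ 2 := by
      calc ∑ i, x i = ∑ i, √(x i) ^ 2 :=
            Finset.sum_congr rfl fun i _ => (Real.sq_sqrt (hx i).le).symm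
        _ ≤ _ := Finset.sum_sq_le_sq_sum_of_nonneg fun i _ => Real.sqrt_nonneg _
    have e2 : ∑ i, y i ^ 2 ≤ (∑ i, y i) ^ 2 :=
      Finset.sum_sq_le_sq_sum_of_nonneg fun i _ => (hy i).le
    have hsy : 0 ≤ ∑ i, y i := Finset.sum_nonneg fun i _ => (hy i).le
    have hss : 0 ≤ ∑ i, √(x i) := Finset.sum_nonneg fun i _ => Real.sqrt_nonneg _
    have hse : 0 < √ε := Real.sqrt_pos.2 hε
    have : δ ≤ ∑ i, √(x i) + ∑ i, y i := by
      refine (abs_le_of_sq_le_sq' ?_ (by positivity)).2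
      nlinarith [mul_nonneg hsy hss]
    linarith
  set A := ε + ∑ i, x i + ∑ i, y i
  set B := √ε + ∑ i, √(x i) + ∑ i, y i
  rw [← Real.rpow_intCast]
  have s1 : A ^ (((-k : ℤ)) : ℝ) ≤ A ^ (-K) * B ^ (K - k) := by
    calc A ^ (((-k : ℤ)) : ℝ) = A ^ (-K) * A ^ (K - k) := by
          rw [← Real.rpow_add hA]; congr 1; push_cast; ring
      _ ≤ _ := by gcongr
  have s2 : A ^ (-K) ≤ ∏ i, y i ^ (-q) := by
    have : -q = -K / N := by rw [hq]; ring
    rw [this]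
    exact prod_bound (by positivity) y (fun i => (hy i).le) _ fun i =>
      Real.rpow_le_rpow_of_nonpos (hy i) (hyA i) (by linarith)
  have s3 : B ^ (K - k) * B ^ (-(2 * (h : ℝ) - α)) ≤
      M ^ ((K - k - (2 * h - α)) - (-E)) * B ^ (-E) := by
    rw [← Real.rpow_add hB, ← sub_eq_add_neg]
    exact rpow_shift hB hBM (by linarith)
  have s4 : ∀ z c : ℝ, 0 < z → z ≤ B → 0 ≤ c → B ^ (-c) ≤ 2 ^ c * (δ + z) ^ (-c) := by
    intro z c hz hzB hc
    calc B ^ (-c) ≤ ((δ + z) / 2) ^ (-c) :=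
          Real.rpow_le_rpow_of_nonpos (by positivity) (by linarith) (by linarith)
      _ = _ := by
        rw [Real.div_rpow (by positivity) (by positivity), Real.rpow_neg (by positivity : (0 : ℝ) ≤ 2)]
        field_simp
  have s5 : B ^ (-E) ≤ 2 ^ E * ((∏ i, (δ + √(x i)) ^ (-(2 + η))) *
        ∏ i, (δ + y i) ^ (-(2 - q + η))) := by
    have e1 : B ^ (-E) = (∏ _i : ι, B ^ (-(2 + η))) * ∏ _i : κ, B ^ (-(2 - q + η)) := by
      rw [Finset.prod_const, Finset.prod_const, Finset.card_univ, Finset.card_univ,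
        ← Real.rpow_natCast, ← Real.rpow_natCast, ← Real.rpow_mul hB.le, ← Real.rpow_mul hB.le,
        ← Real.rpow_add hB, hE]
      congr 1; ring
    have e2 : (2 : ℝ) ^ E = (∏ _i : ι, (2 : ℝ) ^ (2 + η)) * ∏ _i : κ, (2 : ℝ) ^ (2 - q + η) := by
      rw [Finset.prod_const, Finset.prod_const, Finset.card_univ, Finset.card_univ,
        ← Real.rpow_natCast, ← Real.rpow_natCast, ← Real.rpow_mul two_pos.le,
        ← Real.rpow_mul two_pos.le, ← Real.rpow_add two_pos, hE]
      congr 1; ring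
    rw [e1, e2, mul_mul_mul_comm, ← Finset.prod_mul_distrib, ← Finset.prod_mul_distrib]
    have p1 : ∀ i, 0 < √(x i) := fun i => Real.sqrt_pos.2 (hx i)
    refine mul_le_mul ?_ ?_ (Finset.prod_nonneg fun i _ => by positivity)
      (Finset.prod_nonneg fun i _ => by positivity)
    · exact Finset.prod_le_prod (fun i _ => by positivity)
        fun i _ => s4 _ _ (p1 i) (hxB i) (by linarith)
    · exact Finset.prod_le_prod (fun i _ => by positivity)
        fun i _ => s4 _ _ (hy i) (hyB i) (by linarith)
  have hYn : 0 ≤ ∏ i, y i ^ (-q) := Finset.prod_nonneg fun i _ => Real.rpow_nonneg (hy i).le _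
  calc _ ≤ (A ^ (-K) * B ^ (K - k)) * B ^ (-(2 * (h : ℝ) - α)) := by gcongr
    _ = A ^ (-K) * (B ^ (K - k) * B ^ (-(2 * (h : ℝ) - α))) := by ring
    _ ≤ (∏ i, y i ^ (-q)) * (M ^ ((K - k - (2 * h - α)) - (-E)) * (2 ^ E *
        ((∏ i, (δ + √(x i)) ^ (-(2 + η))) * ∏ i, (δ + y i) ^ (-(2 - q + η))))) := by
        refine mul_le_mul s2 (s3.trans ?_) (by positivity) hYn
        gcongr
    _ = _ := by rw [Finset.prod_mul_distrib]; ring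

end pointwise

/-- The integration lemma: a product majorant controls the integral. -/
lemma integral_le_of_product (s m N : ℕ) (R : Set ((Fin s → ℝ) × (Fin m → ℝ) × (Fin N → ℂ)))
    (hR : MeasurableSet R) (F : (Fin s → ℝ) × (Fin m → ℝ) × (Fin N → ℂ) → ℝ)
    (f : ℝ → ℝ) (g : ℂ → ℝ) (hf : Integrable f) (hg : Integrable g)
    (hf0 : ∀ x, 0 ≤ f x) (hg0 : ∀ x, 0 ≤ g x) (C : ℝ) (hC : 0 ≤ C)
    (hF0 : ∀ p, 0 ≤ F p)
    (hF : ∀ p ∈ R, (∀ i, p.1 i ≠ 0) → (∀ i, p.2.1 i ≠ 0) → (∀ i, p.2.2 i ≠ 0) →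
      F p ≤ C * ((∏ i, f (p.1 i)) * ((∏ i, f (p.2.1 i)) * ∏ i, g (p.2.2 i)))) :
    ∫ p in R, F p ≤ C * ((∫ x, f x) ^ (s + m) * (∫ x, g x) ^ N) := by
  set G : (Fin s → ℝ) × (Fin m → ℝ) × (Fin N → ℂ) → ℝ := fun p =>
    C * ((∏ i, f (p.1 i)) * ((∏ i, f (p.2.1 i)) * ∏ i, g (p.2.2 i))) with hG
  have i1 : ∀ t : ℕ, Integrable (fun z : Fin t → ℝ => ∏ i, f (z i)) := fun t =>
    Integrable.fintype_prod (fun _ => hf)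
  have i2 : Integrable (fun z : Fin N → ℂ => ∏ i, g (z i)) :=
    Integrable.fintype_prod (fun _ => hg)
  have hGi : Integrable G := ((i1 s).mul_prod ((i1 m).mul_prod i2)).const_mul C
  have hG0 : ∀ p, 0 ≤ G p := fun p => by
    have a1 : 0 ≤ ∏ i, f (p.1 i) := Finset.prod_nonneg fun i _ => hf0 _
    have a2 : 0 ≤ ∏ i, f (p.2.1 i) := Finset.prod_nonneg fun i _ => hf0 _
    have a3 : 0 ≤ ∏ i, g (p.2.2 i) := Finset.prod_nonneg fun i _ => hg0 _
    rw [hG]; positivity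
  have hGv : ∫ p, G p = C * ((∫ x, f x) ^ (s + m) * (∫ x, g x) ^ N) := by
    rw [hG, integral_const_mul]
    congr 1
    rw [Measure.volume_eq_prod, integral_prod_mul (fun z : Fin s → ℝ => ∏ i, f (z i))
      (fun z : (Fin m → ℝ) × (Fin N → ℂ) => (∏ i, f (z.1 i)) * ∏ i, g (z.2 i)),
      Measure.volume_eq_prod, integral_prod_mul (fun z : Fin m → ℝ => ∏ i, f (z i))
      (fun z : (Fin N → ℂ) => ∏ i, g (z i)), integral_fintype_prod_volume_eq_pow,
      integral_fintype_prod_volume_eq_pow, integral_fintype_prod_volume_eq_pow]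
    simp [pow_add, mul_assoc]
  have hae : ∀ᵐ p : (Fin s → ℝ) × (Fin m → ℝ) × (Fin N → ℂ),
      (∀ i, p.1 i ≠ 0) ∧ (∀ i, p.2.1 i ≠ 0) ∧ (∀ i, p.2.2 i ≠ 0) := by
    have b1 := Measure.quasiMeasurePreserving_fst (μ := (volume : Measure (Fin s → ℝ)))
      (ν := (volume : Measure ((Fin m → ℝ) × (Fin N → ℂ)))).ae (ae_ne_pi (E := ℝ) s)
    have b2 := Measure.quasiMeasurePreserving_snd (μ := (volume : Measure (Fin s → ℝ)))
      (ν := (volume : Measure ((Fin m → ℝ) × (Fin N → ℂ)))).ae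
      (Measure.quasiMeasurePreserving_fst (μ := (volume : Measure (Fin m → ℝ)))
      (ν := (volume : Measure (Fin N → ℂ))).ae (ae_ne_pi (E := ℝ) m))
    have b3 := Measure.quasiMeasurePreserving_snd (μ := (volume : Measure (Fin s → ℝ)))
      (ν := (volume : Measure ((Fin m → ℝ) × (Fin N → ℂ)))).ae
      (Measure.quasiMeasurePreserving_snd (μ := (volume : Measure (Fin m → ℝ)))
      (ν := (volume : Measure (Fin N → ℂ))).ae (ae_ne_pi (E := ℂ) N))
    filter_upwards [b1, b2, b3] with p h1 h2 h3 using ⟨h1, h2, h3⟩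
  calc ∫ p in R, F p ≤ ∫ p in R, G p := by
        refine integral_mono_of_nonneg (Filter.Eventually.of_forall hF0) hGi.integrableOn ?_
        filter_upwards [ae_restrict_of_ae hae, ae_restrict_mem hR] with p h1 h2
        exact hF p h2 h1.1 h1.2.1 h1.2.2
    _ ≤ ∫ p, G p := setIntegral_le_integral hGi (Filter.Eventually.of_forall hG0)
    _ = _ := hGv

/-- Lemma (Integral estimates), case `𝓘₂{α,k,h,s}` with `0 < α < 1`: under either
(`k ≥ 2n-2m` and `k+h-s ≤ 2n-m`) or (`k ≤ 2n-2m-1` and `k+2(h-s) ≤ 2n+2`), the integral of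
`K{α,k,h,s}` over `B(1) \ V(δ)` is `O(δ^(α-2))`. -/
theorem I2_estimate_alpha_sub_two (n m s : ℕ) (hm : 0 < m) (hmn : m < n) (k h : ℤ)
    (α : ℝ) (hα0 : 0 < α) (hα1 : α < 1)
    (hcase : (2 * (n : ℤ) - 2 * (m : ℤ) ≤ k ∧ k + h - (s : ℤ) ≤ 2 * (n : ℤ) - (m : ℤ)) ∨
      (k ≤ 2 * (n : ℤ) - 2 * (m : ℤ) - 1 ∧ k + 2 * (h - (s : ℤ)) ≤ 2 * (n : ℤ) + 2)) :
    ∃ C > (0 : ℝ),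
      ∀ ε ∈ Set.Ioo (0 : ℝ) 1, ∀ δ ∈ Set.Ioo (0 : ℝ) 1,
        (∫ x : (Fin s → ℝ) × (Fin m → ℝ) × (Fin (n - m) → ℂ) in
            {p : (Fin s → ℝ) × (Fin m → ℝ) × (Fin (n - m) → ℂ) |
              (∑ i, p.1 i ^ 2) + (∑ i, p.2.1 i ^ 2) + (∑ i, ‖p.2.2 i‖ ^ 2) < 1} \
            {p : (Fin s → ℝ) × (Fin m → ℝ) × (Fin (n - m) → ℂ) |
              (∑ i, |p.1 i|) + (∑ i, |p.2.1 i|) + (∑ i, ‖p.2.2 i‖ ^ 2) < δ ^ 2},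
          (ε + (∑ i, |x.1 i|) + (∑ i, |x.2.1 i|) + ∑ i, ‖x.2.2 i‖) ^ (-k) *
            (Real.sqrt ε + (∑ i, Real.sqrt |x.1 i|) + (∑ i, Real.sqrt |x.2.1 i|) +
              ∑ i, ‖x.2.2 i‖) ^ (-(2 * (h : ℝ) - α)))
        ≤ C * δ ^ (α - 2) := by
  obtain ⟨N, rfl⟩ : ∃ N, n = m + N := ⟨n - m, by omega⟩
  rw [Nat.add_sub_cancel_left]
  have hN : 0 < N := by omega
  have : Nonempty (Fin m) := ⟨⟨0, hm⟩⟩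
  have : Nonempty (Fin N) := ⟨⟨0, hN⟩⟩
  have hcι : Fintype.card (Fin s ⊕ Fin m) = s + m := by simp
  have hcκ : Fintype.card (Fin N) = N := by simp
  have hmR : (1 : ℝ) ≤ m := by exact_mod_cast hm
  have hsR : (0 : ℝ) ≤ s := by positivity
  have hNR : (1 : ℝ) ≤ N := by exact_mod_cast hN
  have hmeas : ∀ δ : ℝ, MeasurableSet
      ({p : (Fin s → ℝ) × (Fin m → ℝ) × (Fin N → ℂ) |
          (∑ i, p.1 i ^ 2) + (∑ i, p.2.1 i ^ 2) + (∑ i, ‖p.2.2 i‖ ^ 2) < 1} \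
        {p : (Fin s → ℝ) × (Fin m → ℝ) × (Fin N → ℂ) |
          (∑ i, |p.1 i|) + (∑ i, |p.2.1 i|) + (∑ i, ‖p.2.2 i‖ ^ 2) < δ ^ 2}) := by
    intro δ
    refine MeasurableSet.diff ?_ ?_
    · exact (isOpen_lt (by fun_prop) continuous_const).measurableSet
    · exact (isOpen_lt (by fun_prop) continuous_const).measurableSet
  have hball : ∀ p : (Fin s → ℝ) × (Fin m → ℝ) × (Fin N → ℂ),
      (∑ i, p.1 i ^ 2) + (∑ i, p.2.1 i ^ 2) + (∑ i, ‖p.2.2 i‖ ^ 2) < 1 →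
      (∀ i, |p.1 i| ≤ 1) ∧ (∀ i, |p.2.1 i| ≤ 1) ∧ (∀ i, ‖p.2.2 i‖ ≤ 1) := by
    intro p hp
    have a1 : 0 ≤ ∑ i, p.1 i ^ 2 := Finset.sum_nonneg fun i _ => sq_nonneg _
    have a2 : 0 ≤ ∑ i, p.2.1 i ^ 2 := Finset.sum_nonneg fun i _ => sq_nonneg _
    have a3 : 0 ≤ ∑ i, ‖p.2.2 i‖ ^ 2 := Finset.sum_nonneg fun i _ => sq_nonneg _
    refine ⟨fun i => ?_, fun i => ?_, fun i => ?_⟩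
    · have := Finset.single_le_sum (f := fun i => p.1 i ^ 2) (fun i _ => sq_nonneg _)
        (Finset.mem_univ i)
      exact (sq_le_one_iff_abs_le_one _).1 (by linarith)
    · have := Finset.single_le_sum (f := fun i => p.2.1 i ^ 2) (fun i _ => sq_nonneg _)
        (Finset.mem_univ i)
      exact (sq_le_one_iff_abs_le_one _).1 (by linarith)
    · have := Finset.single_le_sum (f := fun i => ‖p.2.2 i‖ ^ 2) (fun i _ => sq_nonneg _)
        (Finset.mem_univ i)
      exact (le_abs_self _).trans
        ((sq_le_one_iff_abs_le_one _).1 (by linarith))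
  have hF0 : ∀ ε : ℝ, 0 < ε → ∀ p : (Fin s → ℝ) × (Fin m → ℝ) × (Fin N → ℂ),
      0 ≤ (ε + (∑ i, |p.1 i|) + (∑ i, |p.2.1 i|) + ∑ i, ‖p.2.2 i‖) ^ (-k) *
            (Real.sqrt ε + (∑ i, Real.sqrt |p.1 i|) + (∑ i, Real.sqrt |p.2.1 i|) +
              ∑ i, ‖p.2.2 i‖) ^ (-(2 * (h : ℝ) - α)) := by
    intro ε hε p
    positivity
  have hδ1 : ∀ δ ∈ Set.Ioo (0 : ℝ) 1, 1 ≤ δ ^ (α - 2) := fun δ hδ =>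
    Real.one_le_rpow_of_pos_of_le_one_of_nonpos hδ.1 hδ.2.le (by linarith)
  rcases hcase with ⟨h1, h2⟩ | ⟨h1, h2⟩
  · obtain ⟨C, hC, hpt⟩ := case1_pointwise (ι := Fin s ⊕ Fin m) (κ := Fin N) k h α hα0 hα1
      (by rw [hcκ]; push_cast at h1; linarith)
      (by rw [hcκ, hcι]; push_cast at h2 ⊢; linarith)
    rw [hcι, hcκ] at hpt
    set a1 : ℝ := (((s + m : ℕ) : ℝ) - α / 4) / ((s + m : ℕ) : ℝ) with ha1
    set a2 : ℝ := (2 * (N : ℝ) - α / 4) / N with ha2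
    have hsm : (1 : ℝ) ≤ ((s + m : ℕ) : ℝ) := by push_cast; linarith
    have ha1' : a1 < 1 := by rw [ha1, div_lt_one (by linarith)]; linarith
    have ha10 : 0 < a1 := by rw [ha1]; apply div_pos <;> linarith
    have ha2' : a2 < 2 := by rw [ha2, div_lt_iff₀ (by linarith)]; linarith
    have ha20 : 0 < a2 := by rw [ha2]; apply div_pos <;> linarith
    have hf := (radial_scaled (E := ℝ) a1 2 (1 / 2) (by norm_num) (by norm_num)
      (by simpa using ha1') (by simp; linarith) 1 one_pos).1
    have hg := (radial_scaled (E := ℂ) a2 2 1 (by norm_num) (by norm_num)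
      (by simpa using ha2') (by simp; linarith) 1 one_pos).1
    set f : ℝ → ℝ := fun x => ‖x‖ ^ (-a1) * (1 + ‖x‖ ^ (1 / 2 : ℝ)) ^ (-2 : ℝ) with hfdef
    set g : ℂ → ℝ := fun x => ‖x‖ ^ (-a2) * (1 + ‖x‖ ^ (1 : ℝ)) ^ (-2 : ℝ) with hgdef
    have hf0 : ∀ x, 0 ≤ f x := fun x => by rw [hfdef]; positivity
    have hg0 : ∀ x, 0 ≤ g x := fun x => by rw [hgdef]; positivity
    have aux : ∀ z : ℝ, 0 ≤ z → z ≤ 1 → 1 ≤ 4 * (1 + z) ^ (-2 : ℝ) := by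
      intro z hz0 hz1
      have : (2 : ℝ) ^ (-2 : ℝ) ≤ (1 + z) ^ (-2 : ℝ) :=
        Real.rpow_le_rpow_of_nonpos (by linarith) (by linarith) (by norm_num)
      have e : (2 : ℝ) ^ (-2 : ℝ) = 1 / 4 := by
        rw [Real.rpow_neg (by norm_num)]; norm_num
      rw [e] at this
      linarith
    have hfb : ∀ x : ℝ, |x| ≤ 1 → |x| ^ (-a1) ≤ 4 * f x := by
      intro x hx
      have := aux (|x| ^ (1 / 2 : ℝ)) (by positivity)
        (Real.rpow_le_one (abs_nonneg _) hx (by norm_num))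
      have h0 : 0 ≤ |x| ^ (-a1) := by positivity
      simp only [hfdef, Real.norm_eq_abs]
      nlinarith
    have hgb : ∀ x : ℂ, ‖x‖ ≤ 1 → ‖x‖ ^ (-a2) ≤ 4 * g x := by
      intro x hx
      have := aux (‖x‖ ^ (1 : ℝ)) (by positivity)
        (Real.rpow_le_one (norm_nonneg _) hx (by norm_num))
      have h0 : 0 ≤ ‖x‖ ^ (-a2) := by positivity
      simp only [hgdef]
      nlinarith
    set C' : ℝ := C * (4 ^ s * (4 ^ m * 4 ^ N)) with hC'
    have hC'0 : 0 < C' := by positivity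
    set I : ℝ := C' * ((∫ x, f x) ^ (s + m) * (∫ x, g x) ^ N) with hI
    have hI0 : 0 ≤ I := by
      have := integral_nonneg (μ := volume) (f := f) hf0
      have := integral_nonneg (μ := volume) (f := g) hg0
      positivity
    refine ⟨I + 1, by linarith, ?_⟩
    intro ε hε δ hδ
    refine (integral_le_of_product s m N _ (hmeas δ) _ f g hf hg hf0 hg0 C' hC'0.le
      (hF0 ε hε.1) ?_).trans ?_
    · intro p hp n1 n2 n3
      obtain ⟨b1, b2, b3⟩ := hball p hp.1
      have := hpt ε hε.1 hε.2 (Sum.elim (fun i => |p.1 i|) (fun i => |p.2.1 i|))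
        (fun i => ‖p.2.2 i‖)
        (by rintro (i | i) <;> simp [n1, n2]) (fun i => by simp [n3])
        (by rintro (i | i) <;> simp [b1, b2]) b3
      simp only [Fintype.sum_sum_type, Fintype.prod_sum_type, Sum.elim_inl, Sum.elim_inr,
        ← add_assoc, neg_div] at this
      refine this.trans ?_
      rw [← ha1, ← ha2]
      have q1 : ∏ i, |p.1 i| ^ (-a1) ≤ 4 ^ s * ∏ i, f (p.1 i) := by
        calc _ ≤ ∏ i, (4 * f (p.1 i)) :=
              Finset.prod_le_prod (fun i _ => by positivity) fun i _ => hfb _ (b1 i)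
          _ = _ := by simp [Finset.prod_mul_distrib]
      have q2 : ∏ i, |p.2.1 i| ^ (-a1) ≤ 4 ^ m * ∏ i, f (p.2.1 i) := by
        calc _ ≤ ∏ i, (4 * f (p.2.1 i)) :=
              Finset.prod_le_prod (fun i _ => by positivity) fun i _ => hfb _ (b2 i)
          _ = _ := by simp [Finset.prod_mul_distrib]
      have q3 : ∏ i, ‖p.2.2 i‖ ^ (-a2) ≤ 4 ^ N * ∏ i, g (p.2.2 i) := by
        calc _ ≤ ∏ i, (4 * g (p.2.2 i)) :=
              Finset.prod_le_prod (fun i _ => by positivity) fun i _ => hgb _ (b3 i)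
          _ = _ := by simp [Finset.prod_mul_distrib]
      have r1 : 0 ≤ ∏ i, |p.1 i| ^ (-a1) := Finset.prod_nonneg fun i _ => by positivity
      have r2 : 0 ≤ ∏ i, |p.2.1 i| ^ (-a1) := Finset.prod_nonneg fun i _ => by positivity
      have r3 : 0 ≤ ∏ i, ‖p.2.2 i‖ ^ (-a2) := Finset.prod_nonneg fun i _ => by positivity
      calc _ ≤ C * ((4 ^ s * ∏ i, f (p.1 i)) * (4 ^ m * ∏ i, f (p.2.1 i)) *
            (4 ^ N * ∏ i, g (p.2.2 i))) := by
            refine mul_le_mul_of_nonneg_left ?_ hC.le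
            exact mul_le_mul (mul_le_mul q1 q2 r2 (r1.trans q1)) q3 r3
              (mul_nonneg (r1.trans q1) (r2.trans q2))
        _ = _ := by rw [hC']; ring
    · have := hδ1 δ hδ
      nlinarith
  · set q : ℝ := max (k : ℝ) 0 / N with hq
    set η : ℝ := (2 - α) / (((s + m : ℕ) : ℝ) + N) with hη
    obtain ⟨C, hC, hpt⟩ := case2_pointwise (ι := Fin s ⊕ Fin m) (κ := Fin N) k h α hα0 hα1
      (by rw [hcκ]; push_cast at h1; linarith)
      (by rw [hcκ, hcι]; push_cast at h2 ⊢; linarith) q η (by rw [hcκ]) (by rw [hcκ, hcι])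
    have hsm : (1 : ℝ) ≤ ((s + m : ℕ) : ℝ) := by push_cast; linarith
    have hη0 : 0 < η := by rw [hη]; apply div_pos <;> linarith
    have hq0 : 0 ≤ q := by positivity
    have h1' : (k : ℝ) ≤ 2 * N - 1 := by
      have : k ≤ 2 * (N : ℤ) - 1 := by push_cast at h1; linarith
      exact_mod_cast this
    have hq2 : q < 2 := by
      rw [hq, div_lt_iff₀ (by linarith)]; apply max_lt <;> linarith
    have hηN : η * (((s + m : ℕ) : ℝ) + N) = 2 - α := by rw [hη]; field_simp
    have hf := radial_scaled (E := ℝ) 0 (2 + η) (1 / 2) (by norm_num) (by linarith)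
      (by simp) (by simp; linarith)
    have hg := radial_scaled (E := ℂ) q (2 - q + η) 1 (by norm_num) (by linarith)
      (by simpa using hq2) (by simp; linarith)
    set J1 : ℝ := ∫ x : ℝ, ‖x‖ ^ (-0 : ℝ) * (1 + ‖x‖ ^ (1 / 2 : ℝ)) ^ (-(2 + η)) with hJ1
    set J2 : ℝ := ∫ x : ℂ, ‖x‖ ^ (-q) * (1 + ‖x‖ ^ (1 : ℝ)) ^ (-(2 - q + η)) with hJ2
    have hJ10 : 0 ≤ J1 := integral_nonneg fun x => by positivity
    have hJ20 : 0 ≤ J2 := integral_nonneg fun x => by positivity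
    refine ⟨C * (J1 ^ (s + m) * J2 ^ N) + 1, by positivity, ?_⟩
    intro ε hε δ hδ
    have hδ0 := hδ.1
    obtain ⟨hf1, hf2⟩ := hf δ hδ.1
    obtain ⟨hg1, hg2⟩ := hg δ hδ.1
    refine (integral_le_of_product s m N _ (hmeas δ) _ _ _ hf1 hg1
      (fun x => by positivity) (fun x => by positivity) C hC.le (hF0 ε hε.1) ?_).trans ?_
    · intro p hp n1 n2 n3
      obtain ⟨b1, b2, b3⟩ := hball p hp.1
      have hreg : δ ^ 2 ≤ (∑ i, |p.1 i|) + (∑ i, |p.2.1 i|) + (∑ i, ‖p.2.2 i‖ ^ 2) :=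
        not_lt.1 hp.2
      have := hpt ε hε.1 hε.2 δ hδ.1 (Sum.elim (fun i => |p.1 i|) (fun i => |p.2.1 i|))
        (fun i => ‖p.2.2 i‖)
        (by rintro (i | i) <;> simp [n1, n2]) (fun i => by simp [n3])
        (by rintro (i | i) <;> simp [b1, b2]) b3
        (by simpa only [Fintype.sum_sum_type, Sum.elim_inl, Sum.elim_inr] using hreg)
      simp only [Fintype.sum_sum_type, Fintype.prod_sum_type, Sum.elim_inl, Sum.elim_inr,
        ← add_assoc] at this
      refine this.trans (le_of_eq ?_)
      simp only [neg_zero, Real.rpow_zero, one_mul, Real.rpow_one, Real.norm_eq_abs,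
        Real.sqrt_eq_rpow, mul_assoc]
    · rw [hf2, hg2, mul_pow, mul_pow]
      have e1 : (δ ^ (((Module.finrank ℝ ℝ : ℝ) - 0) / (1 / 2) - (2 + η))) ^ (s + m) *
          (δ ^ (((Module.finrank ℝ ℂ : ℝ) - q) / 1 - (2 - q + η))) ^ N = δ ^ (α - 2) := by
        rw [← Real.rpow_natCast, ← Real.rpow_natCast, ← Real.rpow_mul hδ0.le,
          ← Real.rpow_mul hδ0.le, ← Real.rpow_add hδ0]
        congr 1
        simp only [Module.finrank_self, Complex.finrank_real_complex]
        push_cast at hηN ⊢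
        linear_combination -hηN
      have e2 : 0 < δ ^ (α - 2) := by positivity
      calc _ = C * (J1 ^ (s + m) * J2 ^ N) * δ ^ (α - 2) := by rw [← e1]; ring
        _ ≤ _ := by nlinarith
end

section
/- Let $\widetilde U\subseteq\mathbb{C}^n$ be open, $1<m<n$, $q\ge 2$ with $q+m\le n$, and let $\rho_1,\dots,\rho_m\in C^\infty(\widetilde U,\mathbb{R})$ satisfy $\partial\rho_1\wedge\cdots\wedge\partial\rho_m\neq 0$ on $\widetilde U$; set $U=\{z\in\widetilde U:\rho_1(z)=\cdots=\rho_m(z)=0\}$, $\rho(\zeta)=(\sum_{k=1}^m\rho_k(\zeta)^2)^{1/2}$, and $\theta(\zeta)=(-\rho_1(\zeta)/\rho(\zeta),\dots,-\rho_m(\zeta)/\rho(\zeta))\in\mathbb{S}^{m-1}$ for $\zeta\notin U$. Suppose there are $C^2$ maps $a_j:\mathbb{S}^{m-1}\times U\to\mathbb{C}^n$, $j=1,\dots,n-q-m$, such that $a_1(\theta,z),\dots,a_{n-q-m}(\theta,z)$ are orthonormal for every $(\theta,z)$, and there is $c>0$ such that for all $(\theta,z)\in\mathbb{S}^{m-1}\times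 U$ and all $w\in\mathbb{C}^n$: $\mathcal{H}_z\rho_\theta(w)+\mathcal{A}(\theta,z,w)\ge c\,|w|^2$, where $\rho_\theta=\sum_k\theta_k\rho_k$, $A_j(\theta,z,w)=\sum_{i=1}^n a_{ji}(\theta,z)w_i$ and $\mathcal{A}(\theta,z,w)=\sum_{j=1}^{n-q-m}A_j(\theta,z,w)\overline{A_j(\theta,z,w)}$. Define $F^{(k)}(\zeta,z)=-\sum_{i=1}^n\frac{\partial\rho_k}{\partial\zeta_i}(z)(\zeta_i-z_i)$ and $\Phi(\zeta,z)=\sum_{k=1}^m F^{(k)}(\zeta,z)\overline{F^{(k)}(\zeta,z)}+\tfrac14\,\mathcal{A}(\theta(\zeta),z,\zeta-z)^2$. Then every point of $U$ has an open neighborhood $\widetilde U'\subseteq\widetilde U$ in $\mathbb{C}^n$ and a constant $C>0$ such that $|\Phi(\zeta,z)|\ge C\,\big(\rho(\zeta)+|\zeta-z|^2\big)^2$ for all $(\zeta,z)\in(\widetilde U'\setminus U)\times(U\cap\widetilde U')$; i.e., $\Phi$ is a strong $\mathbf{M}$-barrier. -/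
/-- The Wirtinger derivative `∂f/∂ζₐ = ½(∂f/∂xₐ - i ∂f/∂yₐ)` on `ℂⁿ`. -/
noncomputable def wirt {n : ℕ} (a : Fin n) (f : EuclideanSpace ℂ (Fin n) → ℂ)
    (z : EuclideanSpace ℂ (Fin n)) : ℂ :=
  (fderiv ℝ f z (EuclideanSpace.single a 1) -
    Complex.I * fderiv ℝ f z (EuclideanSpace.single a Complex.I)) / 2

/-- The conjugate Wirtinger derivative `∂f/∂ζ̄ₐ = ½(∂f/∂xₐ + i ∂f/∂yₐ)` on `ℂⁿ`. -/
noncomputable def wirtBar {n : ℕ} (a : Fin n) (f : EuclideanSpace ℂ (Fin n) → ℂ)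
    (z : EuclideanSpace ℂ (Fin n)) : ℂ :=
  (fderiv ℝ f z (EuclideanSpace.single a 1) +
    Complex.I * fderiv ℝ f z (EuclideanSpace.single a Complex.I)) / 2

/-- The (real-valued) Hessian form
`𝓗_zρ(w) = ∑ ρ_{ζₐζ̄_b}(z) wₐw̄_b + Re{∑ ρ_{ζₐζ_b}(z) wₐw_b}` of a real-valued function. -/
noncomputable def hessR {n : ℕ} (ρ : EuclideanSpace ℂ (Fin n) → ℝ)
    (z w : EuclideanSpace ℂ (Fin n)) : ℝ :=
  (∑ a, ∑ b, wirt a (fun y => wirtBar b (fun x => (ρ x : ℂ)) y) z * w a *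
      (starRingEnd ℂ) (w b)).re +
    (∑ a, ∑ b, wirt a (fun y => wirt b (fun x => (ρ x : ℂ)) y) z * w a * w b).re


/-- Second order Taylor estimate, uniform in the base point. -/
lemma taylor_unif {E : Type*} [NormedAddCommGroup E] [NormedSpace ℝ E] (f : E → ℝ) (z₀ : E)
    (hf : ContDiffAt ℝ 2 f z₀) (ε : ℝ) (hε : 0 < ε) :
    ∃ δ > 0, ∀ z ∈ Metric.ball z₀ δ, ∀ ζ ∈ Metric.ball z₀ δ,
      |f ζ - f z - fderiv ℝ f z (ζ - z) - 1 / 2 * fderiv ℝ (fderiv ℝ f) z (ζ - z) (ζ - z)|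
        ≤ ε * ‖ζ - z‖ ^ 2 := by
  have hev : ∀ᶠ x in nhds z₀, ContDiffAt ℝ 2 f x := hf.eventually (by simp)
  have hcd : ContDiffAt ℝ 1 (fderiv ℝ f) z₀ := hf.fderiv_right (by norm_num)
  have hcd2 : ContDiffAt ℝ 0 (fderiv ℝ (fderiv ℝ f)) z₀ := hcd.fderiv_right (by norm_num)
  have hcont : ContinuousAt (fderiv ℝ (fderiv ℝ f)) z₀ := hcd2.continuousAt
  have hev2 : ∀ᶠ x in nhds z₀,
      dist (fderiv ℝ (fderiv ℝ f) x) (fderiv ℝ (fderiv ℝ f) z₀) < ε / 2 :=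
    Metric.tendsto_nhds.1 hcont.tendsto (ε / 2) (by positivity)
  obtain ⟨δ, hδ, H⟩ := Metric.eventually_nhds_iff_ball.1 (hev.and hev2)
  refine ⟨δ, hδ, fun z hz ζ hζ => ?_⟩
  set w := ζ - z with hw
  have hseg : ∀ t ∈ Set.Icc (0 : ℝ) 1, z + t • w ∈ Metric.ball z₀ δ := by
    intro t ht
    exact (convex_ball z₀ δ).add_smul_sub_mem hz hζ ht
  have hd : ∀ x ∈ Metric.ball z₀ δ, DifferentiableAt ℝ f x := fun x hx =>
    (H x hx).1.differentiableAt (by norm_num)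
  have hd2 : ∀ x ∈ Metric.ball z₀ δ, DifferentiableAt ℝ (fderiv ℝ f) x := fun x hx =>
    ((H x hx).1.fderiv_right (m := 1) (by norm_num)).differentiableAt (by norm_num)
  -- first order estimate for the derivative
  have h1 : ∀ x ∈ Metric.ball z₀ δ,
      ‖fderiv ℝ f x - fderiv ℝ f z - fderiv ℝ (fderiv ℝ f) z (x - z)‖ ≤ ε * ‖x - z‖ := by
    intro x hx
    refine (convex_ball z₀ δ).norm_image_sub_le_of_norm_hasFDerivWithin_le'
      (f' := fderiv ℝ (fderiv ℝ f))
      (fun y hy => (hd2 y hy).hasFDerivAt.hasFDerivWithinAt) ?_ hz hx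
    intro y hy
    rw [← dist_eq_norm]
    have e1 := (H y hy).2
    have e2 := (H z hz).2
    have := dist_triangle_right (fderiv ℝ (fderiv ℝ f) y) (fderiv ℝ (fderiv ℝ f) z)
      (fderiv ℝ (fderiv ℝ f) z₀)
    linarith
  let g : ℝ → ℝ := fun t => f (z + t • w) - t * fderiv ℝ f z w
    - t ^ 2 / 2 * fderiv ℝ (fderiv ℝ f) z w w
  have hg : ∀ t ∈ Set.Icc (0 : ℝ) 1, HasDerivWithinAt g
      (fderiv ℝ f (z + t • w) w - fderiv ℝ f z w - t * fderiv ℝ (fderiv ℝ f) z w w)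
      (Set.Icc 0 1) t := by
    intro t ht
    have hl : HasDerivAt (fun t : ℝ => z + t • w) w t := by
      simpa using ((hasDerivAt_id t).smul_const w).const_add z
    have e1 : HasDerivAt (fun t : ℝ => f (z + t • w)) (fderiv ℝ f (z + t • w) w) t :=
      (hd _ (hseg t ht)).hasFDerivAt.comp_hasDerivAt t hl
    have e2 : HasDerivAt (fun t : ℝ => t * fderiv ℝ f z w) (fderiv ℝ f z w) t := by
      simpa using (hasDerivAt_id t).mul_const (fderiv ℝ f z w)
    have e3 : HasDerivAt (fun t : ℝ => t ^ 2 / 2 * fderiv ℝ (fderiv ℝ f) z w w)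
        (t * fderiv ℝ (fderiv ℝ f) z w w) t := by
      have := (((hasDerivAt_id t).pow 2).div_const 2).mul_const (fderiv ℝ (fderiv ℝ f) z w w)
      simpa using this
    exact ((e1.sub e2).sub e3).hasDerivWithinAt
  have hb : ∀ t ∈ Set.Icc (0 : ℝ) 1,
      ‖fderiv ℝ f (z + t • w) w - fderiv ℝ f z w - t * fderiv ℝ (fderiv ℝ f) z w w‖
        ≤ ε * ‖w‖ ^ 2 := by
    intro t ht
    have e := h1 _ (hseg t ht)
    have e' := (fderiv ℝ f (z + t • w) - fderiv ℝ f z -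
      fderiv ℝ (fderiv ℝ f) z (z + t • w - z)).le_opNorm w
    simp only [add_sub_cancel_left, map_smul, sub_apply,
      smul_apply, smul_eq_mul] at e e'
    refine e'.trans ?_
    rw [norm_smul, Real.norm_of_nonneg ht.1] at e
    have e3 : ε * (t * ‖w‖) ≤ ε * ‖w‖ := by
      have : t * ‖w‖ ≤ 1 * ‖w‖ := by gcongr; exact ht.2
      rw [one_mul] at this
      gcongr
    calc _ ≤ (ε * ‖w‖) * ‖w‖ := by
          gcongr; exact e.trans e3
      _ = _ := by ring
  have key := (convex_Icc (0 : ℝ) 1).norm_image_sub_le_of_norm_hasDerivWithin_le hg hb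
    (Set.left_mem_Icc.2 zero_le_one) (Set.right_mem_Icc.2 zero_le_one)
  simp only [g, hw, Real.norm_eq_abs] at key
  simp only [one_smul, zero_smul, add_zero, add_sub_cancel, one_mul, zero_mul, sub_zero,
    abs_one, mul_one, one_pow] at key
  convert key using 2
  ring

lemma sum_apply_wirt {n : ℕ} (T : EuclideanSpace ℂ (Fin n) →L[ℝ] ℂ)
    (w : EuclideanSpace ℂ (Fin n)) :
    T w = ∑ i, (((w i).re : ℂ) * T (EuclideanSpace.single i 1) +
      ((w i).im : ℂ) * T (EuclideanSpace.single i Complex.I)) := by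
  have hw : w = ∑ i, ((w i).re • EuclideanSpace.single i (1 : ℂ) +
      (w i).im • EuclideanSpace.single i Complex.I) := by
    ext j
    simp [Finset.sum_add_distrib, Pi.single_apply]
  conv_lhs => rw [hw]
  simp [map_sum, map_add, map_smul]

lemma lin_part {n : ℕ} (T : EuclideanSpace ℂ (Fin n) →L[ℝ] ℂ)
    (w : EuclideanSpace ℂ (Fin n)) :
    ∑ i, (T (EuclideanSpace.single i 1) -
      Complex.I * T (EuclideanSpace.single i Complex.I)) / 2 * w i =
    (T w - Complex.I * T (Complex.I • w)) / 2 := by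
  rw [sum_apply_wirt T w, sum_apply_wirt T (Complex.I • w), Finset.mul_sum,
    ← Finset.sum_sub_distrib, Finset.sum_div]
  refine Finset.sum_congr rfl fun i _ => ?_
  have h := Complex.re_add_im (w i)
  have hI := Complex.I_mul_I
  simp only [PiLp.smul_apply, smul_eq_mul, Complex.mul_re, Complex.mul_im, Complex.I_re,
    Complex.I_im, zero_mul, one_mul, zero_sub, zero_add, add_zero, Complex.ofReal_neg]
  nth_rewrite 1 [← h]
  linear_combination (-(1:ℂ) / 2 * (w i).im * T (EuclideanSpace.single i Complex.I)) * hI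

lemma bar_part {n : ℕ} (T : EuclideanSpace ℂ (Fin n) →L[ℝ] ℂ)
    (w : EuclideanSpace ℂ (Fin n)) :
    ∑ i, (T (EuclideanSpace.single i 1) +
      Complex.I * T (EuclideanSpace.single i Complex.I)) / 2 * (starRingEnd ℂ) (w i) =
    (T w + Complex.I * T (Complex.I • w)) / 2 := by
  rw [sum_apply_wirt T w, sum_apply_wirt T (Complex.I • w), Finset.mul_sum,
    ← Finset.sum_add_distrib, Finset.sum_div]
  refine Finset.sum_congr rfl fun i _ => ?_
  have h : (starRingEnd ℂ) (w i) = (w i).re - (w i).im * Complex.I := by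
    apply Complex.ext <;> simp
  have hI := Complex.I_mul_I
  simp only [PiLp.smul_apply, smul_eq_mul, Complex.mul_re, Complex.mul_im, Complex.I_re,
    Complex.I_im, zero_mul, one_mul, zero_sub, zero_add, add_zero, Complex.ofReal_neg]
  rw [h]
  linear_combination (-(1:ℂ) / 2 * (w i).im * T (EuclideanSpace.single i Complex.I)) * hI

lemma fderiv_ofReal {E : Type*} [NormedAddCommGroup E] [NormedSpace ℝ E] {f : E → ℝ} {z : E}
    (hf : DifferentiableAt ℝ f z) (u : E) :
    fderiv ℝ (fun x => (f x : ℂ)) z u = (fderiv ℝ f z u : ℂ) := by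
  have : HasFDerivAt (fun x => (f x : ℂ)) (Complex.ofRealCLM.comp (fderiv ℝ f z)) z :=
    Complex.ofRealCLM.hasFDerivAt.comp z hf.hasFDerivAt
  rw [this.fderiv]
  simp

/-- `2 Re ∂f(w) = Df(w)`. -/
lemma re_wirt {n : ℕ} {f : EuclideanSpace ℂ (Fin n) → ℝ} {z : EuclideanSpace ℂ (Fin n)}
    (hf : DifferentiableAt ℝ f z) (w : EuclideanSpace ℂ (Fin n)) :
    2 * (∑ i, wirt i (fun x => (f x : ℂ)) z * w i).re = fderiv ℝ f z w := by
  unfold wirt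
  rw [lin_part, fderiv_ofReal hf, fderiv_ofReal hf]
  simp
  ring

lemma fderiv2_ofReal {E : Type*} [NormedAddCommGroup E] [NormedSpace ℝ E] {f : E → ℝ} {z : E}
    (hf : ContDiffAt ℝ 2 f z) (u v : E) :
    fderiv ℝ (fderiv ℝ (fun x => (f x : ℂ))) z u v = (fderiv ℝ (fderiv ℝ f) z u v : ℂ) := by
  have hev : ∀ᶠ x in nhds z, ContDiffAt ℝ 2 f x := hf.eventually (by simp)
  have h1 : DifferentiableAt ℝ (fderiv ℝ f) z :=
    (hf.fderiv_right (m := 1) (by norm_num)).differentiableAt (by norm_num)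
  have hF : ContDiffAt ℝ 2 (fun x => (f x : ℂ)) z :=
    Complex.ofRealCLM.contDiff.contDiffAt.comp z hf
  have h2 : DifferentiableAt ℝ (fderiv ℝ (fun x => (f x : ℂ))) z :=
    (hF.fderiv_right (m := 1) (by norm_num)).differentiableAt (by norm_num)
  have e : (fun y => fderiv ℝ (fun x => (f x : ℂ)) y v) =ᶠ[nhds z]
      fun y => ((fderiv ℝ f y v : ℝ) : ℂ) := by
    filter_upwards [hev] with y hy
    exact fderiv_ofReal (hy.differentiableAt (by norm_num)) v
  have h3 : fderiv ℝ (fun y => fderiv ℝ (fun x => (f x : ℂ)) y v) z u =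
      fderiv ℝ (fderiv ℝ (fun x => (f x : ℂ))) z u v := by
    rw [(h2.hasFDerivAt.clm_apply (hasFDerivAt_const v z)).fderiv]; simp
  have h4 : fderiv ℝ (fun y => fderiv ℝ f y v) z u = fderiv ℝ (fderiv ℝ f) z u v := by
    rw [(h1.hasFDerivAt.clm_apply (hasFDerivAt_const v z)).fderiv]; simp
  rw [← h3, e.fderiv_eq, fderiv_ofReal, h4]
  exact h1.clm_apply (differentiableAt_const v)

lemma hessR_eq {n : ℕ} {f : EuclideanSpace ℂ (Fin n) → ℝ} {z : EuclideanSpace ℂ (Fin n)}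
    (hf : ContDiffAt ℝ 2 f z) (w : EuclideanSpace ℂ (Fin n)) :
    hessR f z w = 1 / 2 * fderiv ℝ (fderiv ℝ f) z w w := by
  have hF : ContDiffAt ℝ 2 (fun x => (f x : ℂ)) z :=
    Complex.ofRealCLM.contDiff.contDiffAt.comp z hf
  have h2 : DifferentiableAt ℝ (fderiv ℝ (fun x => (f x : ℂ))) z :=
    (hF.fderiv_right (m := 1) (by norm_num)).differentiableAt (by norm_num)
  have hv : ∀ v, HasFDerivAt (fun y => fderiv ℝ (fun x => (f x : ℂ)) y v)
      ((fderiv ℝ (fderiv ℝ (fun x => (f x : ℂ))) z).flip v) z := by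
    intro v
    refine (h2.hasFDerivAt.clm_apply (hasFDerivAt_const v z)).congr_fderiv ?_
    ext u; simp
  set B := fderiv ℝ (fderiv ℝ (fun x => (f x : ℂ))) z with hB
  have hbar : ∀ b u, fderiv ℝ (fun y => wirtBar b (fun x => (f x : ℂ)) y) z u =
      (B u (EuclideanSpace.single b 1) + Complex.I * B u (EuclideanSpace.single b Complex.I)) / 2 := by
    intro b u
    have := ((hv (EuclideanSpace.single b 1)).add
      ((hv (EuclideanSpace.single b Complex.I)).const_mul Complex.I)).mul_const ((2:ℂ)⁻¹)
    unfold wirtBar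
    simp only [div_eq_mul_inv]
    erw [this.fderiv]
    simp; ring
  have hlin : ∀ b u, fderiv ℝ (fun y => wirt b (fun x => (f x : ℂ)) y) z u =
      (B u (EuclideanSpace.single b 1) - Complex.I * B u (EuclideanSpace.single b Complex.I)) / 2 := by
    intro b u
    have := ((hv (EuclideanSpace.single b 1)).sub
      ((hv (EuclideanSpace.single b Complex.I)).const_mul Complex.I)).mul_const ((2:ℂ)⁻¹)
    unfold wirt
    simp only [div_eq_mul_inv]
    erw [this.fderiv]
    simp; ring
  have m1 : ∑ a, ∑ b, wirt a (fun y => wirtBar b (fun x => (f x : ℂ)) y) z * w a *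
      (starRingEnd ℂ) (w b) =
      ((B w w + Complex.I * B w (Complex.I • w)) / 2 -
        Complex.I * ((B (Complex.I • w) w + Complex.I * B (Complex.I • w) (Complex.I • w)) / 2)) / 2 := by
    rw [Finset.sum_comm, ← bar_part (B w), ← bar_part (B (Complex.I • w)), Finset.mul_sum,
      ← Finset.sum_sub_distrib, Finset.sum_div]
    refine Finset.sum_congr rfl fun b _ => ?_
    rw [← Finset.sum_mul]
    have := lin_part (fderiv ℝ (fun y => wirtBar b (fun x => (f x : ℂ)) y) z) w
    unfold wirt
    rw [this, hbar, hbar]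
    ring
  have m2 : ∑ a, ∑ b, wirt a (fun y => wirt b (fun x => (f x : ℂ)) y) z * w a * w b =
      ((B w w - Complex.I * B w (Complex.I • w)) / 2 -
        Complex.I * ((B (Complex.I • w) w - Complex.I * B (Complex.I • w) (Complex.I • w)) / 2)) / 2 := by
    rw [Finset.sum_comm, ← lin_part (B w), ← lin_part (B (Complex.I • w)), Finset.mul_sum,
      ← Finset.sum_sub_distrib, Finset.sum_div]
    refine Finset.sum_congr rfl fun b _ => ?_
    rw [← Finset.sum_mul]
    have := lin_part (fderiv ℝ (fun y => wirt b (fun x => (f x : ℂ)) y) z) w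
    rw [hlin, hlin] at this
    conv_lhs => enter [1, 2, a]; rw [wirt]
    rw [this]
    ring
  unfold hessR
  rw [m1, m2, ← Complex.add_re]
  have : ∀ u v, B u v = (fderiv ℝ (fderiv ℝ f) z u v : ℂ) := fderiv2_ofReal hf
  simp only [this]
  simp
  ring

lemma hessR_sum {n m : ℕ} {ρ : Fin m → EuclideanSpace ℂ (Fin n) → ℝ}
    {z : EuclideanSpace ℂ (Fin n)}
    (hf : ∀ k, ContDiffAt ℝ 2 (ρ k) z) (θ : Fin m → ℝ) (w : EuclideanSpace ℂ (Fin n)) :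
    hessR (fun y => ∑ k, θ k * ρ k y) z w =
      ∑ k, θ k * (1 / 2 * fderiv ℝ (fderiv ℝ (ρ k)) z w w) := by
  have hs : ContDiffAt ℝ 2 (fun y => ∑ k, θ k * ρ k y) z :=
    ContDiffAt.sum fun k _ => contDiffAt_const.mul (hf k)
  rw [hessR_eq hs]
  have hev : ∀ᶠ x in nhds z, ∀ k, ContDiffAt ℝ 2 (ρ k) x :=
    Filter.eventually_all.2 fun k => (hf k).eventually (by simp)
  have e : fderiv ℝ (fun y => ∑ k, θ k * ρ k y) =ᶠ[nhds z]
      fun y => ∑ k, θ k • fderiv ℝ (ρ k) y := by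
    filter_upwards [hev] with y hy
    exact (HasFDerivAt.fun_sum fun k _ =>
      (((hy k).differentiableAt (by norm_num)).hasFDerivAt.const_mul (θ k))).fderiv
  have h1 : ∀ k, DifferentiableAt ℝ (fderiv ℝ (ρ k)) z := fun k =>
    ((hf k).fderiv_right (m := 1) (by norm_num)).differentiableAt (by norm_num)
  have h2 : HasFDerivAt (fun y => ∑ k, θ k • fderiv ℝ (ρ k) y)
      (∑ k, θ k • fderiv ℝ (fderiv ℝ (ρ k)) z) z :=
    HasFDerivAt.fun_sum fun k _ => (h1 k).hasFDerivAt.const_smul (θ k)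
  rw [e.fderiv_eq, h2.fderiv]
  simp only [sum_apply, smul_apply, smul_eq_mul,
    Finset.mul_sum]
  exact Finset.sum_congr rfl fun k _ => by ring

/-- Construction of the strong `M`-barrier `Φ` on a regular `q`-concave CR manifold:
`Φ(ζ,z) = ∑ₖ F⁽ᵏ⁾(ζ,z)F̄⁽ᵏ⁾(ζ,z) + ¼𝓐(θ(ζ),z,ζ-z)²` satisfies
`|Φ(ζ,z)| ≥ C(ρ(ζ)+|ζ-z|²)²` locally. -/
theorem strong_barrier_estimate (n m q : ℕ) (hm1 : 1 < m) (hmn : m < n)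
    (hq : 2 ≤ q) (hqm : q + m ≤ n)
    (Ut : Set (EuclideanSpace ℂ (Fin n))) (hUt : IsOpen Ut)
    (ρ : Fin m → EuclideanSpace ℂ (Fin n) → ℝ)
    (hρ : ∀ k, ContDiffOn ℝ (⊤ : ℕ∞) (ρ k) Ut)
    (hgeneric : ∀ z ∈ Ut, LinearIndependent ℂ
      (fun k : Fin m => fun i : Fin n => wirt i (fun x => (ρ k x : ℂ)) z))
    (a : Fin (n - q - m) → EuclideanSpace ℝ (Fin m) → EuclideanSpace ℂ (Fin n) →
      EuclideanSpace ℂ (Fin n))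
    (ha : ∀ j, ContDiffOn ℝ 2
      (fun pr : EuclideanSpace ℝ (Fin m) × EuclideanSpace ℂ (Fin n) => a j pr.1 pr.2)
      (Metric.sphere 0 1 ×ˢ {z ∈ Ut | ∀ k, ρ k z = 0}))
    (horth : ∀ θ ∈ Metric.sphere (0 : EuclideanSpace ℝ (Fin m)) 1,
      ∀ z ∈ {z ∈ Ut | ∀ k, ρ k z = 0}, Orthonormal ℂ fun j => a j θ z)
    (c : ℝ) (hc : 0 < c)
    (hpos : ∀ θ ∈ Metric.sphere (0 : EuclideanSpace ℝ (Fin m)) 1,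
      ∀ z ∈ {z ∈ Ut | ∀ k, ρ k z = 0}, ∀ w : EuclideanSpace ℂ (Fin n),
        c * ‖w‖ ^ 2 ≤ hessR (fun y => ∑ k, θ k * ρ k y) z w +
          ∑ j, Complex.normSq (∑ i, a j θ z i * w i)) :
    ∀ z₀ ∈ {z ∈ Ut | ∀ k, ρ k z = 0},
      ∃ U', U' ⊆ Ut ∧ IsOpen U' ∧ z₀ ∈ U' ∧ ∃ C > (0 : ℝ),
        ∀ ζ ∈ U' \ {z ∈ Ut | ∀ k, ρ k z = 0},
        ∀ z ∈ {z ∈ Ut | ∀ k, ρ k z = 0} ∩ U',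
          C * (Real.sqrt (∑ k, ρ k ζ ^ 2) + ‖ζ - z‖ ^ 2) ^ 2 ≤
            norm
              ((((∑ k, Complex.normSq
                    (-(∑ i, wirt i (fun x => (ρ k x : ℂ)) z * (ζ i - z i)))) : ℝ) : ℂ) +
                (((1 / 4 * (∑ j, Complex.normSq (∑ i,
                    a j (WithLp.toLp 2 (fun k => -ρ k ζ / Real.sqrt (∑ k', ρ k' ζ ^ 2))) z i *
                      (ζ i - z i))) ^ 2 : ℝ)) : ℂ)) := by
  rintro z₀ ⟨hz₀, hz₀'⟩
  have hcd : ∀ k, ∀ z ∈ Ut, ContDiffAt ℝ 2 (ρ k) z := fun k z hz =>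
    ((hρ k).contDiffAt (hUt.mem_nhds hz)).of_le (WithTop.coe_le_coe.2 (le_top : (2 : ℕ∞) ≤ ⊤))
  have hmpos : (0 : ℝ) < m := by exact_mod_cast (by omega : 0 < m)
  have hε : 0 < c / 2 / m := by positivity
  choose δ hδ hT using fun k => taylor_unif (ρ k) z₀ (hcd k z₀ hz₀) (c / 2 / m) hε
  refine ⟨Ut ∩ ⋂ k, Metric.ball z₀ (δ k), Set.inter_subset_left,
    hUt.inter (isOpen_iInter_of_finite fun k => Metric.isOpen_ball),
    ⟨hz₀, Set.mem_iInter.2 fun k => Metric.mem_ball_self (hδ k)⟩,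
    (min 1 (c / 2)) ^ 2 / 8, by positivity, ?_⟩
  rintro ζ ⟨⟨hζU, hζB⟩, hζ⟩ z ⟨⟨hzU, hz0⟩, -, hzB⟩
  rw [Set.mem_iInter] at hζB hzB
  set R := Real.sqrt (∑ k, ρ k ζ ^ 2) with hR
  have hsum_nonneg : 0 ≤ ∑ k, ρ k ζ ^ 2 := Finset.sum_nonneg fun k _ => sq_nonneg _
  have hR2 : R ^ 2 = ∑ k, ρ k ζ ^ 2 := Real.sq_sqrt hsum_nonneg
  have hRpos : 0 < R := by
    refine Real.sqrt_pos.2 (lt_of_le_of_ne hsum_nonneg fun h0 => hζ ⟨hζU, fun k => ?_⟩)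
    have := (Finset.sum_eq_zero_iff_of_nonneg (fun k _ => sq_nonneg (ρ k ζ))).1 h0.symm k
      (Finset.mem_univ k)
    exact pow_eq_zero_iff (two_ne_zero) |>.1 this
  set θ : EuclideanSpace ℝ (Fin m) := WithLp.toLp 2 (fun k => -ρ k ζ / R) with hθ
  have hθk : ∀ k, θ k = -ρ k ζ / R := fun k => rfl
  have hθsq : ∑ k, θ k ^ 2 = 1 := by
    simp only [hθk, div_pow, neg_sq]
    rw [← Finset.sum_div, ← hR2, div_self (by positivity)]
  have hθs : θ ∈ Metric.sphere (0 : EuclideanSpace ℝ (Fin m)) 1 := by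
    rw [mem_sphere_zero_iff_norm, EuclideanSpace.norm_eq]
    simp only [Real.norm_eq_abs, sq_abs, hθsq, Real.sqrt_one]
  have hp := hpos θ hθs z ⟨hzU, hz0⟩ (ζ - z)
  rw [hessR_sum (fun k => hcd k z hzU)] at hp
  simp only [PiLp.sub_apply] at hp
  set A := ∑ j, Complex.normSq (∑ i, a j θ z i * (ζ i - z i)) with hA
  have hA0 : 0 ≤ A := Finset.sum_nonneg fun j _ => Complex.normSq_nonneg _
  set w := ζ - z with hw
  set G : Fin m → ℂ := fun k => ∑ i, wirt i (fun x => (ρ k x : ℂ)) z * (ζ i - z i) with hG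
  have hGre : ∀ k, 2 * (G k).re = fderiv ℝ (ρ k) z w := fun k =>
    re_wirt ((hcd k z hzU).differentiableAt (by norm_num)) w
  set S := ∑ k, Complex.normSq (-(G k)) with hS
  have hS0 : 0 ≤ S := Finset.sum_nonneg fun j _ => Complex.normSq_nonneg _
  -- linear term
  have hlin : -∑ k, θ k * (G k).re ≤ Real.sqrt S := by
    apply Real.le_sqrt_of_sq_le
    rw [neg_sq]
    refine (Finset.sum_mul_sq_le_sq_mul_sq _ _ _).trans ?_
    rw [hθsq, one_mul]
    refine Finset.sum_le_sum fun k _ => ?_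
    rw [Complex.normSq_neg, Complex.normSq_apply]
    nlinarith [mul_self_nonneg (G k).im]
  have hρθ : ∑ k, θ k * ρ k ζ = -R := by
    have : ∀ k, θ k * ρ k ζ = -(ρ k ζ ^ 2 / R) := fun k => by rw [hθk]; ring
    simp only [this, Finset.sum_neg_distrib]
    rw [← Finset.sum_div, ← hR2]
    field_simp
  have hθ1 : ∀ k, |θ k| ≤ 1 := fun k => by
    rw [← sq_le_one_iff_abs_le_one, ← hθsq]
    exact Finset.single_le_sum (f := fun k => θ k ^ 2) (fun k _ => sq_nonneg _)
      (Finset.mem_univ k)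
  have hTs : ∑ k, θ k * (1 / 2 * fderiv ℝ (fderiv ℝ (ρ k)) z w w) ≤
      ∑ k, (θ k * ρ k ζ - 2 * (θ k * (G k).re) + c / 2 / m * ‖w‖ ^ 2) := by
    refine Finset.sum_le_sum fun k _ => ?_
    have ht := hT k z (hzB k) ζ (hζB k)
    rw [hz0 k, ← hw, ← hGre k] at ht
    set r := ρ k ζ - 0 - 2 * (G k).re - 1 / 2 * fderiv ℝ (fderiv ℝ (ρ k)) z w w with hr
    have h1 : -(θ k * r) ≤ c / 2 / m * ‖w‖ ^ 2 := by
      refine (neg_le_abs _).trans ?_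
      rw [abs_mul]
      calc |θ k| * |r| ≤ 1 * |r| := by gcongr; exact hθ1 k
        _ ≤ _ := by rw [one_mul]; exact ht
    rw [hr] at h1
    linarith
  rw [Finset.sum_add_distrib, Finset.sum_sub_distrib, ← Finset.mul_sum, hρθ, Finset.sum_const,
    Finset.card_univ, Fintype.card_fin, nsmul_eq_mul] at hTs
  have hmm : (m : ℝ) * (c / 2 / m * ‖w‖ ^ 2) = c / 2 * ‖w‖ ^ 2 := by field_simp
  rw [hmm] at hTs
  have hmain : R + c / 2 * ‖w‖ ^ 2 ≤ A + 2 * Real.sqrt S := by linarith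
  have hlow : min 1 (c / 2) * (R + ‖w‖ ^ 2) ≤ A + 2 * Real.sqrt S := by
    refine le_trans ?_ hmain
    rw [mul_add]
    gcongr
    · calc _ ≤ 1 * R := by gcongr; exact min_le_left _ _
        _ = R := one_mul R
    · exact min_le_right _ _
  rw [← Complex.ofReal_add, Complex.norm_real, Real.norm_of_nonneg (by positivity)]
  have hsq : (min 1 (c / 2) * (R + ‖w‖ ^ 2)) ^ 2 ≤ (A + 2 * Real.sqrt S) ^ 2 :=
    pow_le_pow_left₀ (by positivity) hlow 2
  have hSS := Real.sq_sqrt hS0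
  nlinarith [sq_nonneg (A - 2 * Real.sqrt S)]
end
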